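/- arXiv:1208.2561 — 6 statements merged into one kernel-verified Lean document; each statement's English description precedes it below -/
import Mathlib

section
/- Let n ≥ 1, let f, g : {0,1}^n → {−1,0,1}, let 0 < p ≤ 1/2 and 0 < α ≤ 1, and let Ã be any real number with max(A(α,p), (1−p)·4^{αp}) ≤ Ã. Then E_{S∼μ_p}[f̂(S)·ĝ(S)] ≤ 4^{−n} · Ã^n · (|Supp(f)|·|Supp(g)|)^{1−αp}. -/
open Finset

/-- `‖(a,b)‖_q = (|a|^q + |b|^q)^{1/q}`. -/
noncomputable def pairNorm (q a b : ℝ) : ℝ := (|a| ^ q + |b| ^ q) ^ (1 / q)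

/-- `A(α,p) = sup_{0≤x≤1} ‖(1−2px, 1−2p(1−x))‖_{1/(αp)} / ‖(x,1−x)‖_{1/(1−αp)}`. -/
noncomputable def Aconst (α p : ℝ) : ℝ :=
  sSup ((fun x : ℝ =>
      pairNorm (1 / (α * p)) (1 - 2 * p * x) (1 - 2 * p * (1 - x)) /
        pairNorm (1 / (1 - α * p)) x (1 - x)) '' Set.Icc 0 1)

/-- The Fourier coefficient `f̂(S) = E_{x uniform on {0,1}^n}[f(x)·(−1)^{⊕_{i∈S} x_i}]`. -/
noncomputable def fhatCoeff {n : ℕ} (f : (Fin n → ZMod 2) → ℝ) (S : Finset (Fin n)) : ℝ :=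
  (∑ x : Fin n → ZMod 2, f x * (if (∑ i ∈ S, x i) = 0 then (1 : ℝ) else -1)) / 2 ^ n

/-- The character of `ZMod 2` taking the value `-1` at `1`. -/
noncomputable def signChar (a : ZMod 2) : ℝ := if a = 0 then 1 else -1

theorem signChar_add (a b : ZMod 2) : signChar (a + b) = signChar a * signChar b := by
  unfold signChar
  have h : ∀ a b : ZMod 2, (a + b = 0 ↔ (a = 0 ↔ b = 0)) := by decide
  by_cases ha : a = 0 <;> by_cases hb : b = 0 <;> simp [h, ha, hb]

theorem signChar_sum {ι : Type*} (S : Finset ι) (x : ι → ZMod 2) :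
    signChar (∑ i ∈ S, x i) = ∏ i ∈ S, signChar (x i) := by
  classical
  induction S using Finset.induction_on with
  | empty => simp [signChar]
  | insert a S ha ih => rw [sum_insert ha, prod_insert ha, signChar_add, ih]

/-- The average of `χ_S(x) χ_S(y)` over `S ∼ μ_p` is a product kernel. -/
theorem sum_weight_mul_signChar (n : ℕ) (p : ℝ) (x y : Fin n → ZMod 2) :
    ∑ S : Finset (Fin n), p ^ S.card * (1 - p) ^ (n - S.card) *
        (signChar (∑ i ∈ S, x i) * signChar (∑ i ∈ S, y i)) =
      ∏ i, (p * (signChar (x i) * signChar (y i)) + (1 - p)) := by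
  rw [prod_add, powerset_univ]
  refine sum_congr rfl fun S _ => ?_
  rw [signChar_sum, signChar_sum, prod_mul_distrib, prod_mul_distrib, prod_const, prod_const,
    ← compl_eq_univ_sdiff, card_compl, Fintype.card_fin]
  ring

theorem sum_weight_mul_fhatCoeff (n : ℕ) (p : ℝ) (f g : (Fin n → ZMod 2) → ℝ) :
    ∑ S : Finset (Fin n), p ^ S.card * (1 - p) ^ (n - S.card) *
        (fhatCoeff f S * fhatCoeff g S) =
      (∑ x, ∑ y, f x * g y * ∏ i, (p * (signChar (x i) * signChar (y i)) + (1 - p))) /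
        4 ^ n := by
  have key : ∀ S : Finset (Fin n), p ^ S.card * (1 - p) ^ (n - S.card) *
      (fhatCoeff f S * fhatCoeff g S) = (∑ x, ∑ y, f x * g y *
        (p ^ S.card * (1 - p) ^ (n - S.card) *
          (signChar (∑ i ∈ S, x i) * signChar (∑ i ∈ S, y i)))) / 4 ^ n := by
    intro S
    have h4 : (4 : ℝ) ^ n = 2 ^ n * 2 ^ n := by rw [← mul_pow]; norm_num
    unfold fhatCoeff
    rw [div_mul_div_comm, sum_mul_sum, ← h4, ← mul_div_assoc, mul_sum]
    congr 1
    refine sum_congr rfl fun x _ => ?_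
    rw [mul_sum]
    refine sum_congr rfl fun y _ => ?_
    unfold signChar
    ring
  simp_rw [key]
  rw [← sum_div, sum_comm]
  congr 1
  refine sum_congr rfl fun x _ => ?_
  rw [sum_comm]
  refine sum_congr rfl fun y _ => ?_
  rw [← mul_sum, sum_weight_mul_signChar]

theorem pairNorm_mul {q c a b : ℝ} (hq : 0 < q) (hc : 0 ≤ c) :
    pairNorm q (c * a) (c * b) = c * pairNorm q a b := by
  unfold pairNorm
  rw [abs_mul, abs_mul, abs_of_nonneg hc, Real.mul_rpow hc (abs_nonneg _),
    Real.mul_rpow hc (abs_nonneg _), ← mul_add,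
    Real.mul_rpow (by positivity) (by positivity), ← Real.rpow_mul hc,
    mul_one_div_cancel hq.ne', Real.rpow_one]

theorem continuous_pairNorm {q : ℝ} (hq : 0 < q) {u v : ℝ → ℝ} (hu : Continuous u)
    (hv : Continuous v) : Continuous fun x => pairNorm q (u x) (v x) := by
  unfold pairNorm
  have hq' : 0 ≤ 1 / q := by positivity
  exact ((hu.abs.rpow_const fun _ => Or.inr hq.le).add
    (hv.abs.rpow_const fun _ => Or.inr hq.le)).rpow_const fun _ => Or.inr hq'

theorem pairNorm_pos {q a b : ℝ} (h : a ≠ 0 ∨ b ≠ 0) : 0 < pairNorm q a b := by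
  unfold pairNorm
  apply Real.rpow_pos_of_pos
  rcases h with h | h
  · have := Real.rpow_pos_of_pos (abs_pos.mpr h) q
    positivity
  · have := Real.rpow_pos_of_pos (abs_pos.mpr h) q
    positivity

theorem pairNorm_simplex_pos (q x : ℝ) : 0 < pairNorm q x (1 - x) := by
  apply pairNorm_pos
  by_contra! h
  linarith [h.1, h.2]

/-- The supremum defining `Aconst` bounds each of its terms. -/
theorem pairNorm_le_Aconst_mul {α p x : ℝ} (h0 : 0 < α * p) (h1 : α * p < 1)
    (hx : x ∈ Set.Icc (0 : ℝ) 1) :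
    pairNorm (1 / (α * p)) (1 - 2 * p * x) (1 - 2 * p * (1 - x)) ≤
      Aconst α p * pairNorm (1 / (1 - α * p)) x (1 - x) := by
  have hq : 0 < 1 / (1 - α * p) := one_div_pos.mpr (by linarith)
  rw [← div_le_iff₀ (pairNorm_simplex_pos _ _)]
  refine le_csSup ?_ ⟨x, hx, rfl⟩
  refine isCompact_Icc.bddAbove_image (Continuous.continuousOn ?_)
  exact (continuous_pairNorm (one_div_pos.mpr h0) (by fun_prop) (by fun_prop)).div
    (continuous_pairNorm hq (by fun_prop) (by fun_prop))
    fun y => (pairNorm_simplex_pos _ y).ne'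

/-- The two-point operator with kernel `(1, 1 - 2p; 1 - 2p, 1)` has norm at most `Aconst α p`. -/
theorem pairNorm_noise_le {α p a b : ℝ} (h0 : 0 < α * p) (h1 : α * p < 1)
    (ha : 0 ≤ a) (hb : 0 ≤ b) :
    pairNorm (1 / (α * p)) (a + (1 - 2 * p) * b) ((1 - 2 * p) * a + b) ≤
      Aconst α p * pairNorm (1 / (1 - α * p)) a b := by
  have hq : 0 < 1 / (1 - α * p) := one_div_pos.mpr (by linarith)
  have hq' : 0 < 1 / (α * p) := one_div_pos.mpr h0
  rcases (add_nonneg ha hb).eq_or_lt with h | h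
  · obtain rfl : a = 0 := by linarith
    obtain rfl : b = 0 := by linarith
    have hz : ∀ q : ℝ, 0 < q → pairNorm q 0 0 = 0 := fun q hq => by
      simpa using pairNorm_mul (c := 0) (a := 0) (b := 0) hq le_rfl
    rw [mul_zero, add_zero, hz _ hq, hz _ hq', mul_zero]
  · have key := pairNorm_le_Aconst_mul (x := b / (a + b)) h0 h1
      ⟨by positivity, by rw [div_le_one h]; linarith⟩
    have hs := mul_le_mul_of_nonneg_left key h.le
    rw [mul_left_comm, ← pairNorm_mul hq' h.le, ← pairNorm_mul hq h.le] at hs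
    have e1 : (a + b) * (1 - 2 * p * (b / (a + b))) = a + (1 - 2 * p) * b := by
      field_simp; ring
    have e2 : (a + b) * (1 - 2 * p * (1 - b / (a + b))) = (1 - 2 * p) * a + b := by
      field_simp; ring
    have e3 : (a + b) * (b / (a + b)) = b := by field_simp
    have e4 : (a + b) * (1 - b / (a + b)) = a := by field_simp; ring
    rw [e1, e2, e3, e4] at hs
    have hsymm : pairNorm (1 / (1 - α * p)) b a = pairNorm (1 / (1 - α * p)) a b := by
      unfold pairNorm; rw [add_comm]
    rwa [hsymm] at hs

theorem pairNorm_rpow {s a b : ℝ} (hs : 0 < s) (ha : 0 ≤ a) (hb : 0 ≤ b) :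
    pairNorm (1 / s) (a ^ s) (b ^ s) = (a + b) ^ s := by
  unfold pairNorm
  rw [abs_of_nonneg (by positivity), abs_of_nonneg (by positivity), ← Real.rpow_mul ha,
    ← Real.rpow_mul hb, mul_one_div_cancel hs.ne', Real.rpow_one, Real.rpow_one, one_div_one_div]

theorem two_point_inequality {α p a b c d : ℝ} (h0 : 0 < α * p) (h1 : α * p < 1)
    (ha : 0 ≤ a) (hb : 0 ≤ b) (hc : 0 ≤ c) (hd : 0 ≤ d) :
    (a ^ (1 - α * p) + (1 - 2 * p) * b ^ (1 - α * p)) * c ^ (1 - α * p) +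
        ((1 - 2 * p) * a ^ (1 - α * p) + b ^ (1 - α * p)) * d ^ (1 - α * p) ≤
      Aconst α p * ((a + b) ^ (1 - α * p) * (c + d) ^ (1 - α * p)) := by
  set s := 1 - α * p with hs
  have hs0 : 0 < s := by linarith
  have hconj : (1 / (α * p)).HolderConjugate (1 / s) := by
    rw [Real.holderConjugate_iff]
    refine ⟨by rw [lt_div_iff₀ h0]; linarith, ?_⟩
    simp [hs]
  have hold := Real.inner_le_Lp_mul_Lq univ
    ![a ^ s + (1 - 2 * p) * b ^ s, (1 - 2 * p) * a ^ s + b ^ s] ![c ^ s, d ^ s] hconj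
  simp only [Fin.sum_univ_two, Matrix.cons_val_zero, Matrix.cons_val_one] at hold
  change _ ≤ pairNorm _ _ _ * pairNorm _ _ _ at hold
  rw [pairNorm_rpow hs0 hc hd] at hold
  have hn := pairNorm_noise_le (a := a ^ s) (b := b ^ s) h0 h1 (by positivity) (by positivity)
  rw [← hs, pairNorm_rpow hs0 ha hb] at hn
  calc _ ≤ _ := hold
    _ ≤ Aconst α p * (a + b) ^ s * (c + d) ^ s := by gcongr
    _ = _ := by ring

theorem sum_cube_succ {n : ℕ} (F : (Fin (n + 1) → ZMod 2) → ℝ) :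
    ∑ x, F x = ∑ x : Fin n → ZMod 2, F (Fin.cons 0 x) + ∑ x : Fin n → ZMod 2, F (Fin.cons 1 x) := by
  rw [← (Fin.consEquiv fun _ => ZMod 2).sum_comp, Fintype.sum_prod_type]
  exact Fin.sum_univ_two _

/-- Tensorization of the two-point inequality. -/
theorem sum_rpow_mul_kernel_le {α p B : ℝ} (hp2 : p ≤ 1 / 2) (h0 : 0 < α * p)
    (h1 : α * p < 1) (hB0 : 0 ≤ B) (hB : Aconst α p ≤ B) (n : ℕ)
    (F G : (Fin n → ZMod 2) → ℝ) (hF : ∀ x, 0 ≤ F x) (hG : ∀ x, 0 ≤ G x) :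
    ∑ x, ∑ y, F x ^ (1 - α * p) * G y ^ (1 - α * p) *
        ∏ i, (p * (signChar (x i) * signChar (y i)) + (1 - p)) ≤
      B ^ n * ((∑ x, F x) ^ (1 - α * p) * (∑ x, G x) ^ (1 - α * p)) := by
  induction n with
  | zero => simp
  | succ n ih =>
    set s := 1 - α * p with hs
    have hsum : ∀ (H : (Fin (n + 1) → ZMod 2) → ℝ), (∀ x, 0 ≤ H x) → ∀ e : ZMod 2,
        0 ≤ ∑ x : Fin n → ZMod 2, H (Fin.cons e x) := fun H hH e => sum_nonneg fun x _ => hH _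
    have h00 := ih (fun x => F (Fin.cons 0 x)) (fun x => G (Fin.cons 0 x))
      (fun _ => hF _) (fun _ => hG _)
    have h01 := ih (fun x => F (Fin.cons 0 x)) (fun x => G (Fin.cons 1 x))
      (fun _ => hF _) (fun _ => hG _)
    have h10 := ih (fun x => F (Fin.cons 1 x)) (fun x => G (Fin.cons 0 x))
      (fun _ => hF _) (fun _ => hG _)
    have h11 := ih (fun x => F (Fin.cons 1 x)) (fun x => G (Fin.cons 1 x))
      (fun _ => hF _) (fun _ => hG _)
    have htwo := two_point_inequality (α := α) (p := p) h0 h1 (hsum F hF 0) (hsum F hF 1)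
      (hsum G hG 0) (hsum G hG 1)
    rw [← hs] at htwo
    have hr : 0 ≤ 1 - 2 * p := by linarith
    have c0 : signChar 0 = 1 := by simp [signChar]
    have c1 : signChar 1 = -1 := by simp [signChar]
    have e1 : p + (1 - p) = 1 := by ring
    have e2 : -p + (1 - p) = 1 - 2 * p := by ring
    simp only [sum_cube_succ, Fin.prod_univ_succ, Fin.cons_zero, Fin.cons_succ, c0, c1, mul_one,
      one_mul, mul_neg, neg_neg, e1, e2, sum_add_distrib, mul_left_comm _ (1 - 2 * p), ← mul_sum]
    have hBn : 0 ≤ B ^ n := pow_nonneg hB0 n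
    have hpos : 0 ≤ (∑ x : Fin n → ZMod 2, F (Fin.cons 0 x) +
        ∑ x : Fin n → ZMod 2, F (Fin.cons 1 x)) ^ s * (∑ x : Fin n → ZMod 2, G (Fin.cons 0 x) +
        ∑ x : Fin n → ZMod 2, G (Fin.cons 1 x)) ^ s :=
      mul_nonneg (Real.rpow_nonneg (add_nonneg (hsum F hF 0) (hsum F hF 1)) _)
        (Real.rpow_nonneg (add_nonneg (hsum G hG 0) (hsum G hG 1)) _)
    have hfin := mul_le_mul_of_nonneg_left
      (htwo.trans (mul_le_mul_of_nonneg_right hB hpos)) hBn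
    have m01 := mul_le_mul_of_nonneg_left h01 hr
    have m10 := mul_le_mul_of_nonneg_left h10 hr
    rw [pow_succ]
    linarith

theorem kernel_nonneg {p : ℝ} (hp2 : p ≤ 1 / 2) (a b : ZMod 2) :
    0 ≤ p * (signChar a * signChar b) + (1 - p) := by
  unfold signChar
  split_ifs <;> linarith

theorem abs_rpow_eq_abs_of_sign {s t : ℝ} (hs : s ≠ 0) (ht : t = -1 ∨ t = 0 ∨ t = 1) :
    |t| ^ s = |t| := by
  rcases ht with rfl | rfl | rfl <;> simp [hs]

theorem sum_abs_eq_card_support {β : Type*} [Fintype β] (f : β → ℝ)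
    (hf : ∀ x, f x = -1 ∨ f x = 0 ∨ f x = 1) :
    ∑ x, |f x| = ((univ.filter fun x => f x ≠ 0).card : ℝ) := by
  rw [card_filter, Nat.cast_sum]
  refine sum_congr rfl fun x _ => ?_
  rcases hf x with h | h | h <;> simp [h]

/-- for `f, g : {0,1}^n → {−1,0,1}`, `0 < p ≤ 1/2`, `0 < α ≤ 1` and
`max(A(α,p), (1−p)·4^{αp}) ≤ Ã`, we have
`E_{S∼μ_p}[f̂(S)·ĝ(S)] ≤ 4^{−n} · Ã^n · (|Supp(f)|·|Supp(g)|)^{1−αp}`. -/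
theorem stmt1 (n : ℕ) (hn : 1 ≤ n) (f g : (Fin n → ZMod 2) → ℝ)
    (hf : ∀ x, f x = -1 ∨ f x = 0 ∨ f x = 1) (hg : ∀ x, g x = -1 ∨ g x = 0 ∨ g x = 1)
    (p α Atil : ℝ) (hp : 0 < p) (hp2 : p ≤ 1 / 2) (hα : 0 < α) (hα1 : α ≤ 1)
    (hAtil : max (Aconst α p) ((1 - p) * (4 : ℝ) ^ (α * p)) ≤ Atil) :
    (∑ S : Finset (Fin n),
        p ^ S.card * (1 - p) ^ (n - S.card) * (fhatCoeff f S * fhatCoeff g S))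
      ≤ (4 : ℝ) ^ (-(n : ℝ)) * Atil ^ n *
          (((Finset.univ.filter (fun x => f x ≠ 0)).card *
              (Finset.univ.filter (fun x => g x ≠ 0)).card : ℝ)) ^ (1 - α * p) := by
  have h0 : 0 < α * p := mul_pos hα hp
  have h1 : α * p < 1 := by nlinarith
  have hs : 1 - α * p ≠ 0 := by linarith
  have hA := (le_max_left _ _).trans hAtil
  have hA0 : 0 ≤ Atil := by
    refine le_trans ?_ ((le_max_right _ _).trans hAtil)
    have : 0 ≤ 1 - p := by linarith
    positivity
  have main := sum_rpow_mul_kernel_le hp2 h0 h1 hA0 hA n (fun x => |f x|) (fun x => |g x|)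
    (fun _ => abs_nonneg _) (fun _ => abs_nonneg _)
  simp only [abs_rpow_eq_abs_of_sign hs (hf _), abs_rpow_eq_abs_of_sign hs (hg _)] at main
  rw [sum_abs_eq_card_support f hf, sum_abs_eq_card_support g hg,
    ← Real.mul_rpow (by positivity) (by positivity)] at main
  rw [sum_weight_mul_fhatCoeff, Real.rpow_neg (by norm_num), Real.rpow_natCast, mul_assoc,
    div_eq_inv_mul]
  refine mul_le_mul_of_nonneg_left (le_trans ?_ main) (by positivity)
  refine sum_le_sum fun x _ => sum_le_sum fun y _ => ?_
  refine mul_le_mul_of_nonneg_right ?_ (prod_nonneg fun i _ => kernel_nonneg hp2 _ _)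
  rw [← abs_mul]
  exact le_abs_self _
end

section
/- For all 0 < α ≤ 1/9 and 0 < p ≤ 1/2, it holds that A(α,p) ≤ (1 + 2^{−1/α+8})^{αp}. -/
/-- The self-power `x ^ x` is positive on `[0, ∞)`, as `0 ^ 0 = 1`. -/
lemma Real.rpow_self_pos {x : ℝ} (hx : 0 ≤ x) : 0 < x ^ x := by
  rcases hx.eq_or_lt with rfl | h
  · simp
  · exact Real.rpow_pos_of_pos h x

/-- Gibbs' variational inequality for two points: `x log c + H(x) ≤ log (c + 1)`, where `H` is the
binary entropy. -/
lemma rpow_le_add_one_mul_self_rpow {c x y : ℝ} (hc : 0 ≤ c) (hx : 0 ≤ x) (hy : 0 ≤ y)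
    (hxy : x + y = 1) : c ^ x ≤ (c + 1) * (x ^ x * y ^ y) := by
  have h := Real.geom_mean_le_arith_mean2_weighted hx hy (div_nonneg hc hx)
    (div_nonneg zero_le_one hy) hxy
  rw [Real.div_rpow hc hx, Real.div_rpow zero_le_one hy, Real.one_rpow, div_mul_div_comm,
    mul_one] at h
  have h1 : x * (c / x) ≤ c := by
    rcases hx.eq_or_lt with rfl | h'
    · simpa using hc
    · rw [mul_div_cancel₀ _ h'.ne']
  have h2 : y * (1 / y) ≤ 1 := by
    rcases hy.eq_or_lt with rfl | h'
    · simp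
    · rw [mul_div_cancel₀ _ h'.ne']
  rw [div_le_iff₀ (mul_pos (Real.rpow_self_pos hx) (Real.rpow_self_pos hy))] at h
  exact h.trans (mul_le_mul_of_nonneg_right (by linarith)
    (mul_pos (Real.rpow_self_pos hx) (Real.rpow_self_pos hy)).le)

/-- The norm of a probability vector is bounded below by the exponential of minus its entropy. -/
lemma self_rpow_rpow_le_pairNorm {ε x y : ℝ} (hε : 0 < ε) (hε1 : ε < 1) (hx : 0 ≤ x) (hy : 0 ≤ y)
    (hxy : x + y = 1) : (x ^ x * y ^ y) ^ ε ≤ pairNorm (1 / (1 - ε)) x y := by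
  have h1ε : 0 < 1 - ε := by linarith
  have hδ : 0 < ε / (1 - ε) := div_pos hε h1ε
  have hs : 1 / (1 - ε) = 1 + ε / (1 - ε) := by field_simp; ring
  have hpow : ∀ z : ℝ, 0 ≤ z → z ^ (1 / (1 - ε)) = z * z ^ (ε / (1 - ε)) := fun z hz => by
    rw [hs, Real.rpow_add' hz (by positivity), Real.rpow_one]
  have h := Real.geom_mean_le_arith_mean2_weighted hx hy
    (Real.rpow_nonneg hx (ε / (1 - ε))) (Real.rpow_nonneg hy (ε / (1 - ε))) hxy
  rw [← Real.rpow_mul hx, mul_comm _ x, Real.rpow_mul hx, ← Real.rpow_mul hy, mul_comm _ y,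
    Real.rpow_mul hy, ← Real.mul_rpow (by positivity) (by positivity), ← hpow x hx,
    ← hpow y hy] at h
  have h' := Real.rpow_le_rpow (by positivity) h h1ε.le
  rw [← Real.rpow_mul (by positivity), div_mul_cancel₀ _ h1ε.ne'] at h'
  rwa [pairNorm, abs_of_nonneg hx, abs_of_nonneg hy, one_div_one_div]

lemma pairNorm_comm (q a b : ℝ) : pairNorm q a b = pairNorm q b a := by
  rw [pairNorm, pairNorm, add_comm]

lemma one_sub_rpow_le_exp {α p x : ℝ} (hα : 0 < α) (hp : 0 < p) (hpx : 2 * p * x ≤ 1) :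
    |1 - 2 * p * x| ^ (1 / (α * p)) ≤ Real.exp (-(2 / α)) ^ x := by
  rw [abs_of_nonneg (by linarith)]
  refine (Real.rpow_le_rpow (by linarith) (Real.one_sub_le_exp_neg _) (by positivity)).trans_eq ?_
  rw [← Real.exp_mul, ← Real.exp_mul]
  congr 1
  field_simp

lemma three_mul_exp_neg_le_two_rpow {n : ℝ} (hn : 0 ≤ n) :
    3 * Real.exp (-n) ≤ (2 : ℝ) ^ (-n + 8) := by
  rw [Real.rpow_add two_pos, Real.rpow_def_of_pos two_pos (-n)]
  have h : Real.exp (-n) ≤ Real.exp (Real.log 2 * -n) :=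
    Real.exp_le_exp.2 (by nlinarith [Real.log_two_lt_d9])
  have h8 : (2 : ℝ) ^ (8 : ℝ) = 256 := by
    rw [show (8 : ℝ) = (8 : ℕ) by norm_num, Real.rpow_natCast]; norm_num
  rw [h8]
  linarith [Real.exp_pos (-n)]

lemma pairNorm_le_mul_pairNorm {α p x y : ℝ} (hα : 0 < α) (hα1 : α ≤ 1) (hp : 0 < p)
    (hp2 : p ≤ 1 / 2) (hx : 0 ≤ x) (hyx : x ≤ y) (hxy : x + y = 1) :
    pairNorm (1 / (α * p)) (1 - 2 * p * x) (1 - 2 * p * y) ≤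
      (1 + (2 : ℝ) ^ (-1 / α + 8)) ^ (α * p) * pairNorm (1 / (1 - α * p)) x y := by
  have hy : 0 ≤ y := hx.trans hyx
  have hε : 0 < α * p := mul_pos hα hp
  have hε1 : α * p < 1 := by nlinarith
  have hW := mul_pos (Real.rpow_self_pos hx) (Real.rpow_self_pos hy)
  have hsmall : Real.exp (-(2 / α)) ^ y ≤ Real.exp (-(1 / α)) := by
    rw [← Real.exp_mul, Real.exp_le_exp]
    have : 0 < 1 / α := by positivity
    have h2 : 2 / α = 2 * (1 / α) := by ring
    rw [h2]
    nlinarith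
  have hsq : Real.exp (-(2 / α)) ≤ Real.exp (-(1 / α)) := by
    rw [Real.exp_le_exp]
    gcongr
    norm_num
  have hone : 1 ≤ 2 * (x ^ x * y ^ y) := by
    have := rpow_le_add_one_mul_self_rpow zero_le_one hx hy hxy
    rw [Real.one_rpow] at this
    linarith
  have hbig := rpow_le_add_one_mul_self_rpow (Real.exp_pos (-(2 / α))).le hx hy hxy
  have hexp : 3 * Real.exp (-(1 / α)) ≤ (2 : ℝ) ^ (-1 / α + 8) := by
    rw [neg_div]
    exact three_mul_exp_neg_le_two_rpow (by positivity)
  have hsum : |1 - 2 * p * x| ^ (1 / (α * p)) + |1 - 2 * p * y| ^ (1 / (α * p)) ≤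
      (1 + (2 : ℝ) ^ (-1 / α + 8)) * (x ^ x * y ^ y) := by
    calc _ ≤ Real.exp (-(2 / α)) ^ x + Real.exp (-(2 / α)) ^ y :=
          add_le_add (one_sub_rpow_le_exp hα hp (by nlinarith))
            (one_sub_rpow_le_exp hα hp (by nlinarith))
      _ ≤ (Real.exp (-(2 / α)) + 1) * (x ^ x * y ^ y) +
          Real.exp (-(1 / α)) * (2 * (x ^ x * y ^ y)) :=
        add_le_add hbig (hsmall.trans (le_mul_of_one_le_right (Real.exp_pos _).le hone))
      _ = (Real.exp (-(2 / α)) + 1 + 2 * Real.exp (-(1 / α))) * (x ^ x * y ^ y) := by ring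
      _ ≤ _ := mul_le_mul_of_nonneg_right (by linarith) hW.le
  calc pairNorm (1 / (α * p)) (1 - 2 * p * x) (1 - 2 * p * y)
      ≤ ((1 + (2 : ℝ) ^ (-1 / α + 8)) * (x ^ x * y ^ y)) ^ (α * p) := by
        rw [pairNorm, one_div_one_div]
        exact Real.rpow_le_rpow (by positivity) hsum hε.le
    _ = (1 + (2 : ℝ) ^ (-1 / α + 8)) ^ (α * p) * (x ^ x * y ^ y) ^ (α * p) :=
        Real.mul_rpow (by positivity) hW.le
    _ ≤ _ := mul_le_mul_of_nonneg_left (self_rpow_rpow_le_pairNorm hε hε1 hx hy hxy)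
        (by positivity)

/-- for `0 < α ≤ 1/9` and `0 < p ≤ 1/2`,
`A(α,p) ≤ (1 + 2^{−1/α+8})^{αp}`. -/
theorem stmt2 (α p : ℝ) (hα : 0 < α) (hα9 : α ≤ 1 / 9) (hp : 0 < p) (hp2 : p ≤ 1 / 2) :
    Aconst α p ≤ (1 + (2 : ℝ) ^ (-1 / α + 8)) ^ (α * p) := by
  have hα1 : α ≤ 1 := by linarith
  refine csSup_le ((Set.nonempty_Icc.2 zero_le_one).image _) ?_
  rintro _ ⟨x, ⟨hx0, hx1⟩, rfl⟩
  refine div_le_of_le_mul₀ (by unfold pairNorm; positivity) (by positivity) ?_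
  rcases le_total x (1 - x) with h | h
  · exact pairNorm_le_mul_pairNorm hα hα1 hp hp2 hx0 h (by ring)
  · rw [pairNorm_comm, pairNorm_comm _ x]
    exact pairNorm_le_mul_pairNorm hα hα1 hp hp2 (by linarith) h (by ring)
end

section
/- Let n ≥ 1, let 0 < t̃ ≤ 1 be such that 2^{t̃·n} is an integer in {1,...,2^n}, and let f : {0,1}^n → ℝ be a distribution of min-entropy at least t̃·n. Let 0 < p ≤ 1/2. Then E_{S∼μ_p}[|f̃(S)|] ≤ (1/2) · 2^{−p·n·t̃ / (2·log₂(512/t̃))}. -/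
open Finset

/-- The normalized Fourier coefficient `f̃(S) = 2^{n−1}·f̂(S)`. -/
noncomputable def ntildeCoeff {n : ℕ} (f : (Fin n → ZMod 2) → ℝ) (S : Finset (Fin n)) : ℝ :=
  2 ^ (n - 1) * fhatCoeff f S

/-- The sign `(-1)^a` of a bit `a`. -/
noncomputable def bitSign (a : ZMod 2) : ℝ := if a = 0 then 1 else -1

lemma bit_eq_zero_or_one (a : ZMod 2) : a = 0 ∨ a = 1 := by
  revert a
  decide

lemma bitSign_add (a b : ZMod 2) : bitSign (a + b) = bitSign a * bitSign b := by
  have h : (1 + 1 : ZMod 2) = 0 := by decide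
  rcases bit_eq_zero_or_one a with rfl | rfl <;> rcases bit_eq_zero_or_one b with rfl | rfl <;>
    simp [bitSign, h]

lemma bitSign_sum {n : ℕ} (S : Finset (Fin n)) (x : Fin n → ZMod 2) :
    bitSign (∑ i ∈ S, x i) = ∏ i ∈ S, bitSign (x i) := by
  induction S using Finset.induction_on with
  | empty => simp [bitSign]
  | insert a S ha ih => rw [Finset.sum_insert ha, Finset.prod_insert ha, bitSign_add, ih]

lemma ntildeCoeff_eq {n : ℕ} (hn : 1 ≤ n) (f : (Fin n → ZMod 2) → ℝ) (S : Finset (Fin n)) :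
    ntildeCoeff f S = 1 / 2 * ∑ x, f x * ∏ i ∈ S, bitSign (x i) := by
  obtain ⟨k, rfl⟩ := Nat.exists_eq_add_of_le' hn
  simp only [ntildeCoeff, fhatCoeff, ← bitSign_sum, Nat.add_sub_cancel]
  simp only [bitSign]
  field_simp
  ring

/-- The kernel `∏ i, (1 - p + p (-1)^(x i + y i)) = (1 - 2p)^(dist x y)`. -/
noncomputable def noiseKernel {n : ℕ} (p : ℝ) (x y : Fin n → ZMod 2) : ℝ :=
  ∏ i, (p * (bitSign (x i) * bitSign (y i)) + (1 - p))

lemma noiseKernel_nonneg {n : ℕ} {p : ℝ} (hp2 : p ≤ 1 / 2) (x y : Fin n → ZMod 2) :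
    0 ≤ noiseKernel p x y := by
  refine Finset.prod_nonneg fun i _ => ?_
  unfold bitSign
  split_ifs <;> linarith

lemma sum_noiseKernel_pow {n : ℕ} (p : ℝ) (m : ℕ) (x : Fin n → ZMod 2) :
    ∑ y, noiseKernel p x y ^ m = (1 + (1 - 2 * p) ^ m) ^ n := by
  have key (a : ZMod 2) :
      ∑ b : ZMod 2, (p * (bitSign a * bitSign b) + (1 - p)) ^ m = 1 + (1 - 2 * p) ^ m := by
    have h : -p + (1 - p) = 1 - 2 * p := by ring
    have huniv : (Finset.univ : Finset (ZMod 2)) = {0, 1} := rfl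
    rw [huniv]
    rcases bit_eq_zero_or_one a with rfl | rfl <;> simp [bitSign, ← h, add_comm]
  simp only [noiseKernel, ← Finset.prod_pow]
  rw [← Fintype.prod_sum fun i b => (p * (bitSign (x i) * bitSign b) + (1 - p)) ^ m]
  simp [key]

lemma sum_biased_weight_mul_prod {n : ℕ} (p : ℝ) (c : Fin n → ℝ) :
    ∑ S : Finset (Fin n), p ^ S.card * (1 - p) ^ (n - S.card) * ∏ i ∈ S, c i
      = ∏ i, (p * c i + (1 - p)) := by
  rw [Finset.prod_add]
  simp only [Finset.powerset_univ, Finset.prod_mul_distrib, Finset.prod_const]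
  refine Finset.sum_congr rfl fun S _ => ?_
  rw [Finset.card_univ_sdiff, Fintype.card_fin]
  ring

lemma sum_biased_weight {n : ℕ} (p : ℝ) :
    ∑ S : Finset (Fin n), p ^ S.card * (1 - p) ^ (n - S.card) = 1 := by
  simpa using sum_biased_weight_mul_prod (n := n) p 1

lemma sum_biased_weight_mul_sq {n : ℕ} (p : ℝ) (f : (Fin n → ZMod 2) → ℝ) :
    ∑ S : Finset (Fin n), p ^ S.card * (1 - p) ^ (n - S.card) *
        (∑ x, f x * ∏ i ∈ S, bitSign (x i)) ^ 2
      = ∑ x, f x * ∑ y, f y * noiseKernel p x y := by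
  simp only [noiseKernel, ← sum_biased_weight_mul_prod, sq, Finset.sum_mul_sum]
  simp only [Finset.mul_sum, Finset.prod_mul_distrib]
  rw [Finset.sum_comm]
  refine Finset.sum_congr rfl fun x _ => ?_
  rw [Finset.sum_comm]
  refine Finset.sum_congr rfl fun y _ => Finset.sum_congr rfl fun S _ => ?_
  ring

/-- The moment bound `(E |F|)^(2m) ≤ M (1 + (1 - 2p)^m)^n` for a distribution bounded by `M`. -/
lemma sum_biased_weight_mul_abs_pow_le {n : ℕ} {p M : ℝ} (hp : 0 ≤ p) (hp2 : p ≤ 1 / 2)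
    (f : (Fin n → ZMod 2) → ℝ) (hf_nonneg : ∀ x, 0 ≤ f x) (hf_sum : ∑ x, f x = 1)
    (hf_le : ∀ x, f x ≤ M) (m : ℕ) :
    (∑ S : Finset (Fin n), p ^ S.card * (1 - p) ^ (n - S.card) *
        |∑ x, f x * ∏ i ∈ S, bitSign (x i)|) ^ (2 * m)
      ≤ M * (1 + (1 - 2 * p) ^ m) ^ n := by
  have h1p : 0 ≤ 1 - p := by linarith
  have hsq := Real.pow_arith_mean_le_arith_mean_pow Finset.univ
    (fun S : Finset (Fin n) => p ^ S.card * (1 - p) ^ (n - S.card))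
    (fun S => |∑ x, f x * ∏ i ∈ S, bitSign (x i)|)
    (fun S _ => by positivity) (sum_biased_weight p) (fun S _ => abs_nonneg _) 2
  simp only [sq_abs] at hsq
  rw [sum_biased_weight_mul_sq] at hsq
  have hinner_nonneg (x : Fin n → ZMod 2) : 0 ≤ ∑ y, f y * noiseKernel p x y :=
    Finset.sum_nonneg fun y _ => mul_nonneg (hf_nonneg y) (noiseKernel_nonneg hp2 x y)
  rw [pow_mul]
  calc _ ≤ (∑ x, f x * ∑ y, f y * noiseKernel p x y) ^ m :=
        pow_le_pow_left₀ (sq_nonneg _) hsq m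
    _ ≤ ∑ x, f x * (∑ y, f y * noiseKernel p x y) ^ m :=
        Real.pow_arith_mean_le_arith_mean_pow _ _ _ (fun x _ => hf_nonneg x) hf_sum
          (fun x _ => hinner_nonneg x) m
    _ ≤ ∑ x, f x * (M * (1 + (1 - 2 * p) ^ m) ^ n) := by
        refine Finset.sum_le_sum fun x _ => mul_le_mul_of_nonneg_left ?_ (hf_nonneg x)
        calc _ ≤ ∑ y, f y * noiseKernel p x y ^ m :=
              Real.pow_arith_mean_le_arith_mean_pow _ _ _ (fun y _ => hf_nonneg y) hf_sum
                (fun y _ => noiseKernel_nonneg hp2 x y) m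
          _ ≤ ∑ y, M * noiseKernel p x y ^ m :=
              Finset.sum_le_sum fun y _ => mul_le_mul_of_nonneg_right (hf_le y)
                (pow_nonneg (noiseKernel_nonneg hp2 x y) m)
          _ = _ := by rw [← Finset.mul_sum, sum_noiseKernel_pow]
    _ = _ := by rw [← Finset.sum_mul, hf_sum, one_mul]

lemma nine_le_logb {t : ℝ} (ht : 0 < t) (ht1 : t ≤ 1) : 9 ≤ Real.logb 2 (512 / t) := by
  rw [Real.le_logb_iff_rpow_le one_lt_two (by positivity), le_div_iff₀ ht]
  norm_num
  linarith

lemma exists_moment_le {t p : ℝ} (ht : 0 < t) (ht1 : t ≤ 1) (hp : 0 < p) (hp2 : p ≤ 1 / 2) :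
    ∃ m : ℕ, m ≠ 0 ∧
      1 + (1 - 2 * p) ^ m ≤ (2 : ℝ) ^ (t - p * t * m / Real.logb 2 (512 / t)) := by
  set L := Real.logb 2 (512 / t) with hL
  have hL9 : 9 ≤ L := nine_le_logb ht ht1
  have hlog1 : Real.log 2 < 1 := Real.log_two_lt_d9.trans (by norm_num)
  have hlog2 : 1 / 2 < Real.log 2 := lt_trans (by norm_num) Real.log_two_gt_d9
  have hm1 : L / (2 * p) ≤ ⌈L / (2 * p)⌉₊ := Nat.le_ceil _
  have hm2 := Nat.ceil_lt_add_one (show 0 ≤ L / (2 * p) by positivity)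
  have hm0 : 0 < ⌈L / (2 * p)⌉₊ := Nat.ceil_pos.2 (by positivity)
  refine ⟨⌈L / (2 * p)⌉₊, hm0.ne', ?_⟩
  generalize ⌈L / (2 * p)⌉₊ = m at hm1 hm2
  have hlow : L ≤ 2 * p * m := by
    rwa [div_le_iff₀ (by positivity), mul_comm] at hm1
  have hup : p * m ≤ 5 / 9 * L := by
    have h := mul_lt_mul_of_pos_left hm2 hp
    have h' : p * (L / (2 * p) + 1) = L / 2 + p := by field_simp
    linarith
  have hpow : (1 - 2 * p) ^ m ≤ t / 512 := by
    calc (1 - 2 * p) ^ m ≤ Real.exp (-(2 * p)) ^ m :=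
          pow_le_pow_left₀ (by linarith) (by linarith [Real.add_one_le_exp (-(2 * p))]) m
      _ = Real.exp (-(2 * p * m)) := by rw [← Real.exp_nat_mul]; ring_nf
      _ ≤ Real.exp (-(Real.log 2 * L)) := by
          refine Real.exp_le_exp.2 (neg_le_neg ?_)
          nlinarith
      _ = t / 512 := by
          have h : Real.log 2 * L = Real.log (512 / t) := by
            rw [hL, Real.logb]; field_simp
          rw [h, Real.exp_neg, Real.exp_log (by positivity), inv_div]
  have hexp : 4 / 9 * t ≤ t - p * t * m / L := by
    have h : p * t * m / L ≤ 5 / 9 * t := by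
      rw [div_le_iff₀ (by linarith)]
      nlinarith
    linarith
  calc 1 + (1 - 2 * p) ^ m ≤ t / 512 + 1 := by linarith
    _ ≤ Real.exp (t / 512) := Real.add_one_le_exp _
    _ ≤ Real.exp (Real.log 2 * (t - p * t * m / L)) := by
        refine Real.exp_le_exp.2 ?_
        nlinarith
    _ = _ := by rw [Real.rpow_def_of_pos two_pos]

/-- if `f` is a distribution on `{0,1}^n` of min-entropy at least `t̃·n`
with `2^{t̃·n}` an integer in `{1,...,2^n}`, and `0 < p ≤ 1/2`, then
`E_{S∼μ_p}[|f̃(S)|] ≤ (1/2)·2^{−p·n·t̃/(2·log₂(512/t̃))}`. -/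
theorem stmt3 (n : ℕ) (hn : 1 ≤ n) (tt : ℝ) (htt : 0 < tt) (htt1 : tt ≤ 1)
    (hpow : ∃ s : ℕ, 1 ≤ s ∧ s ≤ 2 ^ n ∧ (s : ℝ) = (2 : ℝ) ^ (tt * n))
    (f : (Fin n → ZMod 2) → ℝ)
    (hf_nonneg : ∀ x, 0 ≤ f x) (hf_sum : ∑ x : Fin n → ZMod 2, f x = 1)
    (hf_ent : ∀ x, f x ≤ (2 : ℝ) ^ (-(tt * n)))
    (p : ℝ) (hp : 0 < p) (hp2 : p ≤ 1 / 2) :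
    (∑ S : Finset (Fin n),
        p ^ S.card * (1 - p) ^ (n - S.card) * |ntildeCoeff f S|)
      ≤ 1 / 2 * (2 : ℝ) ^ (-(p * n * tt) / (2 * Real.logb 2 (512 / tt))) := by
  obtain ⟨m, hm0, hm⟩ := exists_moment_le htt htt1 hp hp2
  have hL9 := nine_le_logb htt htt1
  set L := Real.logb 2 (512 / tt)
  have hsum : (∑ S : Finset (Fin n), p ^ S.card * (1 - p) ^ (n - S.card) * |ntildeCoeff f S|)
      = 1 / 2 * ∑ S : Finset (Fin n), p ^ S.card * (1 - p) ^ (n - S.card) *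
          |∑ x, f x * ∏ i ∈ S, bitSign (x i)| := by
    rw [Finset.mul_sum]
    refine Finset.sum_congr rfl fun S _ => ?_
    rw [ntildeCoeff_eq hn, abs_mul, abs_of_pos (by norm_num : (0 : ℝ) < 1 / 2)]
    ring
  rw [hsum]
  refine mul_le_mul_of_nonneg_left ?_ (by norm_num)
  refine le_of_pow_le_pow_left₀ (n := 2 * m) (by positivity) (by positivity) ?_
  refine (sum_biased_weight_mul_abs_pow_le hp.le hp2 f hf_nonneg hf_sum hf_ent m).trans ?_
  have hρ : 0 ≤ 1 - 2 * p := by linarith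
  calc (2 : ℝ) ^ (-(tt * n)) * (1 + (1 - 2 * p) ^ m) ^ n
      ≤ (2 : ℝ) ^ (-(tt * n)) * ((2 : ℝ) ^ (tt - p * tt * m / L)) ^ n := by gcongr
    _ = ((2 : ℝ) ^ (-(p * n * tt) / (2 * L))) ^ (2 * m) := by
        rw [← Real.rpow_mul_natCast two_pos.le, ← Real.rpow_mul_natCast two_pos.le,
          ← Real.rpow_add two_pos]
        congr 1
        push_cast
        field_simp
        ring
end

section
/- If 0 < x ≤ 1 and 0 < r ≤ 1, then 1 + rx/2 ≤ (1+x)^r ≤ 1 + rx. -/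
/-- if `0 < x ≤ 1` and `0 < r ≤ 1`, then `1 + rx/2 ≤ (1+x)^r ≤ 1 + rx`. -/
theorem stmt11 (x r : ℝ) (hx : 0 < x) (hx1 : x ≤ 1) (hr : 0 < r) (hr1 : r ≤ 1) :
    1 + r * x / 2 ≤ (1 + x) ^ r ∧ (1 + x) ^ r ≤ 1 + r * x := by
  have hpos : 0 < 1 + x := by linarith
  refine ⟨?_, rpow_one_add_le_one_add_mul_self (by linarith) hr.le hr1⟩
  have hlog : x / 2 ≤ Real.log (1 + x) := by
    refine le_trans ?_ (Real.one_sub_inv_le_log_of_pos hpos)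
    have h : 1 - (1 + x)⁻¹ = x / (1 + x) := by
      field_simp
      ring
    rw [h]
    exact div_le_div_of_nonneg_left hx.le hpos (by linarith)
  rw [Real.rpow_def_of_pos hpos]
  have hexp := Real.add_one_le_exp (Real.log (1 + x) * r)
  have hmul := mul_le_mul_of_nonneg_left hlog hr.le
  linarith
end

section
/- Let B ⊆ {0,1}^n be non-empty. Then there exist a set of coordinates I ⊆ {1,...,n} and b ∈ {0,1}^I such that |I| ≤ log₂(|B|) and |{x ∈ B : x_i = b_i for all i ∈ I}| = 1. -/
open Finset

/-- If a finite family of functions has two distinct members, then restricting the value at a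
suitable coordinate leaves a non-empty subfamily of at most half the size. -/
theorem exists_coordinate_filter_card_le_half {ι α : Type*} [DecidableEq α]
    {B : Finset (ι → α)} (hB : B.Nontrivial) :
    ∃ i, ∃ u ∈ B, 2 * #{z ∈ B | z i = u i} ≤ #B := by
  obtain ⟨x, hx, y, hy, hxy⟩ := hB
  obtain ⟨i, hi⟩ := Function.ne_iff.mp hxy
  have hdisj : Disjoint {z ∈ B | z i = x i} {z ∈ B | z i = y i} :=
    Finset.disjoint_filter.mpr fun z _ hzx hzy => hi (hzx.symm.trans hzy)
  have hcard : #{z ∈ B | z i = x i} + #{z ∈ B | z i = y i} ≤ #B := by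
    classical
    rw [← Finset.card_union_of_disjoint hdisj]
    exact Finset.card_le_card
      (Finset.union_subset (Finset.filter_subset _ _) (Finset.filter_subset _ _))
  rcases le_total #{z ∈ B | z i = x i} #{z ∈ B | z i = y i} with h | h
  · exact ⟨i, x, hx, by omega⟩
  · exact ⟨i, y, hy, by omega⟩

/-- A non-empty finite family of functions has a member `y` that is isolated in the family by its
values on a set `I` of coordinates with `2 ^ #I ≤ #B`. -/
theorem exists_isolating_coordinates {ι α : Type*}
    (B : Finset (ι → α)) (hB : B.Nonempty) :
    ∃ I : Finset ι, ∃ y ∈ B, 2 ^ #I ≤ #B ∧ ∀ x ∈ B, (∀ i ∈ I, x i = y i) → x = y := by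
  classical
  induction B using Finset.strongInduction with
  | H B ih =>
    rcases hB.exists_eq_singleton_or_nontrivial with ⟨y, rfl⟩ | hnt
    · exact ⟨∅, y, by simp⟩
    · obtain ⟨i, u, hu, hhalf⟩ := exists_coordinate_filter_card_le_half hnt
      have hss : {z ∈ B | z i = u i} ⊂ B := by
        refine (Finset.filter_subset _ _).ssubset_of_ne fun h => ?_
        rw [h] at hhalf
        have := hB.card_pos
        omega
      obtain ⟨I, y, hy, hI, huniq⟩ := ih _ hss ⟨u, by simp [hu]⟩
      obtain ⟨hyB, hyu⟩ := Finset.mem_filter.mp hy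
      refine ⟨insert i I, y, hyB, ?_, fun x hx hxy => ?_⟩
      · calc 2 ^ #(insert i I) ≤ 2 ^ (#I + 1) :=
              Nat.pow_le_pow_right two_pos (Finset.card_insert_le _ _)
          _ ≤ #B := by rw [pow_succ]; omega
      · exact huniq x
          (Finset.mem_filter.mpr ⟨hx, (hxy i (Finset.mem_insert_self i I)).trans hyu⟩)
          fun j hj => hxy j (Finset.mem_insert_of_mem hj)

/-- for any non-empty `B ⊆ {0,1}^n` there exist coordinates `I ⊆ {1,...,n}`
and `b ∈ {0,1}^I` with `|I| ≤ log₂(|B|)` and `|{x ∈ B : x_i = b_i for all i ∈ I}| = 1`. -/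
theorem stmt16 (n : ℕ) (B : Finset (Fin n → ZMod 2)) (hB : B.Nonempty) :
    ∃ (I : Finset (Fin n)) (b : {i : Fin n // i ∈ I} → ZMod 2),
      (I.card : ℝ) ≤ Real.logb 2 (B.card) ∧
      (B.filter (fun x => ∀ i : {i : Fin n // i ∈ I}, x i.val = b i)).card = 1 := by
  obtain ⟨I, y, hy, hI, huniq⟩ := exists_isolating_coordinates B hB
  refine ⟨I, fun i => y i, ?_, Finset.card_eq_one.mpr ⟨y, ?_⟩⟩
  · rw [Real.le_logb_iff_rpow_le one_lt_two (by exact_mod_cast hB.card_pos), Real.rpow_natCast]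
    exact_mod_cast hI
  · ext x
    simp only [Finset.mem_filter, Finset.mem_singleton]
    constructor
    · rintro ⟨hx, hxy⟩
      exact huniq x hx fun i hi => hxy ⟨i, hi⟩
    · rintro rfl
      exact ⟨hy, fun _ => rfl⟩
end

section
/- Let n ≥ 2, let f, g : {0,1}^n → ℝ, and let 0 ≤ p ≤ 1. For b ∈ {0,1} define f_b, g_b : {0,1}^{n−1} → ℝ by f_b(x') := f(x', b) and g_b(x') := g(x', b). Then E_{S∼μ_p over {1,...,n}}[f̂(S)·ĝ(S)] = (1/4)·( E_{S'∼μ_p over {1,...,n−1}}[f̂_0(S')·ĝ_0(S')] + E_{S'}[f̂_1(S')·ĝ_1(S')] + (1−2p)·( E_{S'}[f̂_0(S')·ĝ_1(S')] + E_{S'}[f̂_1(S')·ĝ_0(S')] ) ). -/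
open Finset

theorem sum_finset_fin_succ {M : Type*} [AddCommMonoid M] {n : ℕ}
    (F : Finset (Fin (n + 1)) → M) :
    ∑ S, F S = ∑ S : Finset (Fin n), (F (S.map Fin.castSuccEmb) +
      F (insert (Fin.last n) (S.map Fin.castSuccEmb))) := by
  have hlast : Fin.last n ∉ (univ : Finset (Fin n)).map Fin.castSuccEmb := by simp
  have hmap (G : Finset (Fin (n + 1)) → M) :
      ∑ S ∈ ((univ : Finset (Fin n)).map Fin.castSuccEmb).powerset, G S =
        ∑ S : Finset (Fin n), G (S.map Fin.castSuccEmb) := by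
    rw [map_eq_image, powerset_image, powerset_univ,
      sum_image (image_injective Fin.castSuccEmb.injective).injOn]
    simp only [map_eq_image]
  rw [← powerset_univ, Fin.univ_castSuccEmb, cons_eq_insert, sum_powerset_insert hlast,
    hmap, hmap, sum_add_distrib]

theorem sum_fin_succ_zmod_two {M : Type*} [AddCommMonoid M] {n : ℕ}
    (F : (Fin (n + 1) → ZMod 2) → M) :
    ∑ x, F x = ∑ x : Fin n → ZMod 2, (F (Fin.snoc x 0) + F (Fin.snoc x 1)) := by
  rw [← (Fin.snocEquiv fun _ : Fin (n + 1) => ZMod 2).sum_comp, Fintype.sum_prod_type,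
    sum_add_distrib]
  exact Fin.sum_univ_two _

theorem fhatCoeff_map_castSucc {n : ℕ} (f : (Fin (n + 1) → ZMod 2) → ℝ) (S : Finset (Fin n)) :
    fhatCoeff f (S.map Fin.castSuccEmb) =
      (fhatCoeff (fun x => f (Fin.snoc x 0)) S + fhatCoeff (fun x => f (Fin.snoc x 1)) S) / 2 := by
  simp only [fhatCoeff, sum_fin_succ_zmod_two, sum_map, Fin.coe_castSuccEmb, Fin.snoc_castSucc,
    sum_add_distrib]
  field_simp
  ring

theorem fhatCoeff_insert_last {n : ℕ} (f : (Fin (n + 1) → ZMod 2) → ℝ) (S : Finset (Fin n)) :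
    fhatCoeff f (insert (Fin.last n) (S.map Fin.castSuccEmb)) =
      (fhatCoeff (fun x => f (Fin.snoc x 0)) S - fhatCoeff (fun x => f (Fin.snoc x 1)) S) / 2 := by
  have hlast : Fin.last n ∉ S.map Fin.castSuccEmb := by simp
  have hsign (a : ZMod 2) :
      (if 1 + a = 0 then (1 : ℝ) else -1) = -(if a = 0 then (1 : ℝ) else -1) := by
    have ha : 1 + a = 0 ↔ a ≠ 0 := by revert a; decide
    by_cases h : a = 0 <;> simp [ha, h]
  simp only [fhatCoeff, sum_fin_succ_zmod_two, sum_insert hlast, sum_map, Fin.coe_castSuccEmb,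
    Fin.snoc_castSucc, Fin.snoc_last, zero_add, hsign, sum_add_distrib, mul_neg, sum_neg_distrib]
  field_simp
  ring

/-- the decomposition of `E_{S∼μ_p}[f̂(S)·ĝ(S)]` in dimension `n+1 ≥ 2` in terms
of the restrictions `f_b(x') := f(x',b)`, `g_b(x') := g(x',b)` in dimension `n`:
`E_S[f̂ĝ] = (1/4)·(E_{S'}[f̂₀ĝ₀] + E_{S'}[f̂₁ĝ₁] + (1−2p)·(E_{S'}[f̂₀ĝ₁] + E_{S'}[f̂₁ĝ₀]))`. -/
theorem stmt18 (n : ℕ) (hn : 1 ≤ n) (p : ℝ) (hp0 : 0 ≤ p) (hp1 : p ≤ 1)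
    (f g : (Fin (n + 1) → ZMod 2) → ℝ) :
    (∑ S : Finset (Fin (n + 1)),
        p ^ S.card * (1 - p) ^ (n + 1 - S.card) * (fhatCoeff f S * fhatCoeff g S))
      = (1 / 4) *
        ((∑ S : Finset (Fin n), p ^ S.card * (1 - p) ^ (n - S.card) *
            (fhatCoeff (fun x => f (Fin.snoc x 0)) S * fhatCoeff (fun x => g (Fin.snoc x 0)) S))
          + (∑ S : Finset (Fin n), p ^ S.card * (1 - p) ^ (n - S.card) *
            (fhatCoeff (fun x => f (Fin.snoc x 1)) S * fhatCoeff (fun x => g (Fin.snoc x 1)) S))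
          + (1 - 2 * p) *
            ((∑ S : Finset (Fin n), p ^ S.card * (1 - p) ^ (n - S.card) *
                (fhatCoeff (fun x => f (Fin.snoc x 0)) S *
                  fhatCoeff (fun x => g (Fin.snoc x 1)) S))
              + (∑ S : Finset (Fin n), p ^ S.card * (1 - p) ^ (n - S.card) *
                (fhatCoeff (fun x => f (Fin.snoc x 1)) S *
                  fhatCoeff (fun x => g (Fin.snoc x 0)) S)))) := by
  rw [sum_finset_fin_succ]
  simp only [← sum_add_distrib, mul_sum]
  refine sum_congr rfl fun S _ => ?_
  have hlast : Fin.last n ∉ S.map Fin.castSuccEmb := by simp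
  have hcard : S.card ≤ n := by simpa using card_le_univ S
  rw [fhatCoeff_map_castSucc, fhatCoeff_map_castSucc, fhatCoeff_insert_last,
    fhatCoeff_insert_last, card_insert_of_notMem hlast, card_map, Nat.add_sub_add_right,
    Nat.sub_add_comm hcard]
  ring
end
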